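/- arXiv:1508.02694 — 2 statements merged into one kernel-verified Lean document; each statement's English description precedes it below -/
import Mathlib

section
/- If m is a positive integer of the form 4^k(8ℓ + 5) for some nonnegative integers k and ℓ, then m is not represented by the quadratic form x^2 + 2y^2 + 2yz + 2z^2. -/
theorem even_and_even_of_even_sq_add_mul_add_sq {y z : ℤ}
    (h : Even (y ^ 2 + y * z + z ^ 2)) : Even y ∧ Even z := by
  simp only [Int.even_add, Int.even_mul, Int.even_pow] at h
  tauto

theorem form_ne_eight_mul_add_five (x y z l : ℤ) :
    x ^ 2 + 2 * y ^ 2 + 2 * y * z + 2 * z ^ 2 ≠ 8 * l + 5 := by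
  intro h
  have hx : Odd x := by
    by_contra hx
    obtain ⟨a, rfl⟩ := Int.not_odd_iff_even.mp hx
    ring_nf at h
    omega
  obtain ⟨t, ht⟩ := Int.eight_dvd_sq_sub_one_of_odd hx
  have hN : y ^ 2 + y * z + z ^ 2 = 2 * (2 * (l - t) + 1) := by linarith
  obtain ⟨⟨b, rfl⟩, c, rfl⟩ :=
    even_and_even_of_even_sq_add_mul_add_sq (hN ▸ even_two_mul _)
  ring_nf at hN
  omega

theorem exists_form_eq_of_form_eq_four_mul {x y z n : ℤ}
    (h : x ^ 2 + 2 * y ^ 2 + 2 * y * z + 2 * z ^ 2 = 4 * n) :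
    ∃ x' y' z' : ℤ, x' ^ 2 + 2 * y' ^ 2 + 2 * y' * z' + 2 * z' ^ 2 = n := by
  have hx : Even x := by
    by_contra hx
    obtain ⟨a, rfl⟩ := Int.not_even_iff_odd.mp hx
    ring_nf at h
    omega
  obtain ⟨a, rfl⟩ := hx
  have hN : y ^ 2 + y * z + z ^ 2 = 2 * (n - a ^ 2) := by linarith
  obtain ⟨⟨b, rfl⟩, c, rfl⟩ :=
    even_and_even_of_even_sq_add_mul_add_sq (hN ▸ even_two_mul _)
  exact ⟨a, b, c, by linarith⟩

theorem not_rep_Q2_det3 (m : ℤ) (hm : 0 < m)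
    (h : ∃ k l : ℕ, m = 4 ^ k * (8 * l + 5)) :
    ¬ ∃ x y z : ℤ, x ^ 2 + 2 * y ^ 2 + 2 * y * z + 2 * z ^ 2 = m := by
  obtain ⟨k, l, rfl⟩ := h
  clear hm
  induction k with
  | zero =>
    rintro ⟨x, y, z, h⟩
    exact form_ne_eight_mul_add_five x y z l (by simpa using h)
  | succ k ih =>
    rintro ⟨x, y, z, h⟩
    exact ih (exists_form_eq_of_form_eq_four_mul (h.trans (by ring)))
end

section
/- Let m be a positive integer. If m is not represented by the quadratic form x^2 + y^2 + 3z^2, then 9m is not represented by x^2 + y^2 + 3z^2. -/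
theorem three_dvd_of_three_dvd_sq_add_sq {x y : ℤ} (h : 3 ∣ x ^ 2 + y ^ 2) : 3 ∣ x ∧ 3 ∣ y := by
  simp only [← Nat.cast_ofNat (R := ℤ) (n := 3), ← ZMod.intCast_zmod_eq_zero_iff_dvd] at h ⊢
  push_cast at h
  generalize (x : ZMod 3) = a at h ⊢
  generalize (y : ZMod 3) = b at h ⊢
  revert a b
  decide

theorem not_rep_nine_mul_x2_y2_3z2 (m : ℤ) (hm : 0 < m)
    (h : ¬ ∃ x y z : ℤ, x ^ 2 + y ^ 2 + 3 * z ^ 2 = m) :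
    ¬ ∃ x y z : ℤ, x ^ 2 + y ^ 2 + 3 * z ^ 2 = 9 * m := by
  rintro ⟨x, y, z, e⟩
  obtain ⟨⟨a, rfl⟩, ⟨b, rfl⟩⟩ :=
    three_dvd_of_three_dvd_sq_add_sq (x := x) (y := y) ⟨3 * m - z ^ 2, by linarith⟩
  obtain ⟨c, rfl⟩ : 3 ∣ z :=
    Int.prime_three.dvd_of_dvd_pow (n := 2) ⟨m - a ^ 2 - b ^ 2, by linarith⟩
  exact h ⟨a, b, c, by linarith⟩
end
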